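/- (Corollary: information-state values vs AIS values.) Let {σ_t : ℋ_t → 𝒵_t}_{t=1}^T be an exact information state generator, i.e., there exist reward functions r̄_t and kernels P̄_t such that E[R_t | H_t = h_t, A_t = a_t] = r̄_t(σ_t(h_t), a_t) and P(σ_{t+1}(H_{t+1}) ∈ B | H_t = h_t, A_t = a_t) = P̄_t(B | σ_t(h_t), a_t) for all t, h_t, a_t, B; let Q̄_t, V̄_t be the value functions of the backward recursion V̄_{T+1} ≡ 0, Q̄_t(z,a) = r̄_t(z,a) + ∫ V̄_{t+1} dP̄_t(·|z,a), V̄_t(z) = max_a Q̄_t(z,a). Let {σ̂_t, P̂_t, r̂_t}_{t=1}^T be an (ε_t, δ_t)-AIS generator with value functions Q̂_t, V̂_t. Then for every t, h_t, a_t: |Q̄_t(σ_t(h_t), a_t) − Q̂_t(σ̂_t(h_t), a_t)| ≤ α_t and |V̄_t(σ_t(h_t)) − V̂_t(σ̂_t(h_t))| ≤ α_t, where α_{T+1} = 0 and α_t = ε_t + ρ_𝔉(V̂_{t+1}) δ_t + α_{t+1}. -/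

import Mathlib

open MeasureTheory ProbabilityTheory

universe u

/-- The integral probability metric (IPM) associated with a function class `F`. -/
noncomputable def ipm {X : Type u} [MeasurableSpace X] (F : Set (X → ℝ))
    (μ ν : Measure X) : ℝ :=
  sSup ((fun f => |∫ x, f x ∂μ - ∫ x, f x ∂ν|) '' F)

/-- The Minkowski functional (gauge) of a function `f` with respect to the class `F`. -/
noncomputable def mink {X : Type u} (F : Set (X → ℝ)) (f : X → ℝ) : ℝ :=
  sInf {c : ℝ | 0 < c ∧ (fun x => c⁻¹ * f x) ∈ F}

/-- `F` is a class of uniformly bounded measurable real-valued functions. -/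
def UnifBddMeas {X : Type u} [MeasurableSpace X] (F : Set (X → ℝ)) : Prop :=
  (∀ f ∈ F, Measurable f) ∧ ∃ C : ℝ, ∀ f ∈ F, ∀ x, |f x| ≤ C

/-- History spaces of a partially observed system: `ℋ_{t+1} = ℋ_t × 𝒴 × 𝒜`. -/
def Hist (H0 Y A : Type u) : ℕ → Type u
  | 0 => H0
  | (t+1) => Hist H0 Y A t × Y × A

instance Hist.instMeasurableSpace {H0 Y A : Type u} [MeasurableSpace H0]
    [MeasurableSpace Y] [MeasurableSpace A] :
    ∀ t, MeasurableSpace (Hist H0 Y A t)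
  | 0 => inferInstanceAs (MeasurableSpace H0)
  | (t+1) =>
    letI := Hist.instMeasurableSpace (H0 := H0) (Y := Y) (A := A) t
    inferInstanceAs (MeasurableSpace (Hist H0 Y A t × Y × A))

theorem abs_integral_le_of_abs_le {X : Type*} [MeasurableSpace X] (μ : Measure X)
    [IsProbabilityMeasure μ] {f : X → ℝ} {C : ℝ} (h : ∀ x, |f x| ≤ C) : |∫ x, f x ∂μ| ≤ C := by
  simpa using norm_integral_le_of_norm_le_const (μ := μ) (f := f) (ae_of_all _ h)

theorem abs_integral_map_sub_integral_map_le {Ω X Y : Type*} [MeasurableSpace Ω]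
    [MeasurableSpace X] [MeasurableSpace Y] (μ : Measure Ω) [IsProbabilityMeasure μ]
    {φ : Ω → X} {ψ : Ω → Y} (hφ : Measurable φ) (hψ : Measurable ψ)
    {f : X → ℝ} {g : Y → ℝ} (hf : Measurable f) (hg : Measurable g)
    (hfb : ∃ C : ℝ, ∀ x, |f x| ≤ C) (hgb : ∃ C : ℝ, ∀ y, |g y| ≤ C)
    {c : ℝ} (h : ∀ ω, |f (φ ω) - g (ψ ω)| ≤ c) :
    |∫ x, f x ∂(μ.map φ) - ∫ y, g y ∂(μ.map ψ)| ≤ c := by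
  obtain ⟨C, hC⟩ := hfb
  obtain ⟨C', hC'⟩ := hgb
  rw [integral_map hφ.aemeasurable hf.aestronglyMeasurable,
    integral_map hψ.aemeasurable hg.aestronglyMeasurable, ← integral_sub]
  · exact abs_integral_le_of_abs_le μ h
  · exact .of_bound (hf.comp hφ).aestronglyMeasurable C (ae_of_all _ fun _ => hC _)
  · exact .of_bound (hg.comp hψ).aestronglyMeasurable C' (ae_of_all _ fun _ => hC' _)

theorem abs_integral_sub_le_ipm {X : Type u} [MeasurableSpace X] {F : Set (X → ℝ)}
    (hF : UnifBddMeas F) (μ ν : Measure X) [IsProbabilityMeasure μ] [IsProbabilityMeasure ν]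
    {f : X → ℝ} (hf : f ∈ F) :
    |∫ x, f x ∂μ - ∫ x, f x ∂ν| ≤ ipm F μ ν := by
  obtain ⟨C, hC⟩ := hF.2
  refine le_csSup ⟨C + C, ?_⟩ ⟨f, hf, rfl⟩
  rintro _ ⟨g, hg, rfl⟩
  exact (abs_sub _ _).trans <| add_le_add
    (abs_integral_le_of_abs_le μ (hC g hg)) (abs_integral_le_of_abs_le ν (hC g hg))

theorem abs_integral_sub_le_mink_mul {X : Type u} [MeasurableSpace X] {F : Set (X → ℝ)}
    (hF : UnifBddMeas F) (μ ν : Measure X) [IsProbabilityMeasure μ] [IsProbabilityMeasure ν]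
    {f : X → ℝ} (hf : {c : ℝ | 0 < c ∧ (fun x => c⁻¹ * f x) ∈ F}.Nonempty)
    {δ : ℝ} (hδ : ipm F μ ν ≤ δ) :
    |∫ x, f x ∂μ - ∫ x, f x ∂ν| ≤ mink F f * δ := by
  have le_mul : ∀ c ∈ {c : ℝ | 0 < c ∧ (fun x => c⁻¹ * f x) ∈ F},
      |∫ x, f x ∂μ - ∫ x, f x ∂ν| ≤ c * δ := by
    rintro c ⟨hc, hcF⟩
    have h := (abs_integral_sub_le_ipm hF μ ν hcF).trans hδ
    rwa [integral_const_mul, integral_const_mul, ← mul_sub, abs_mul,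
      abs_of_pos (inv_pos.2 hc), inv_mul_le_iff₀ hc] at h
  obtain ⟨c, hc⟩ := hf
  have hδ0 : 0 ≤ δ := nonneg_of_mul_nonneg_right ((abs_nonneg _).trans (le_mul c hc)) hc.1
  rcases hδ0.eq_or_lt with rfl | hpos
  · simpa using le_mul c hc
  · rw [← div_le_iff₀ hpos]
    exact le_csInf ⟨c, hc⟩ fun b hb => (div_le_iff₀ hpos).2 (le_mul b hb)

theorem abs_ciSup_sub_ciSup_le {ι : Type*} [Finite ι] [Nonempty ι] {f g : ι → ℝ} {c : ℝ}
    (h : ∀ i, |f i - g i| ≤ c) : |(⨆ i, f i) - ⨆ i, g i| ≤ c := by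
  have hf : BddAbove (Set.range f) := (Set.finite_range f).bddAbove
  have hg : BddAbove (Set.range g) := (Set.finite_range g).bddAbove
  rw [abs_sub_le_iff, sub_le_iff_le_add, sub_le_iff_le_add]
  constructor
  · refine ciSup_le fun i => ?_
    linarith [le_ciSup hg i, (abs_sub_le_iff.1 (h i)).1]
  · refine ciSup_le fun i => ?_
    linarith [le_ciSup hf i, (abs_sub_le_iff.1 (h i)).2]

/-- Value functions of a finite-horizon backward recursion are bounded and measurable. -/
theorem measurable_and_bounded_value
    {A : Type u} [MeasurableSpace A] [Finite A] [Nonempty A] (T : ℕ)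
    {Z : ℕ → Type u} [∀ t, MeasurableSpace (Z t)]
    (P : ∀ t, Kernel (Z t × A) (Z (t+1))) [∀ t, IsMarkovKernel (P t)]
    (r : ∀ t, Z t × A → ℝ) (hrm : ∀ t, Measurable (r t)) (hrb : ∃ C : ℝ, ∀ t p, |r t p| ≤ C)
    (Q : ∀ t, Z t → A → ℝ) (V : ∀ t, Z t → ℝ)
    (hVT : ∀ z, V (T+1) z = 0)
    (hQ : ∀ t ≤ T, ∀ (z : Z t) (a : A),
      Q t z a = r t (z, a) + ∫ z', V (t+1) z' ∂((P t) (z, a)))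
    (hV : ∀ t ≤ T, ∀ z : Z t, V t z = ⨆ a : A, Q t z a) :
    ∀ t ≤ T + 1, Measurable (V t) ∧ ∃ C : ℝ, ∀ z, |V t z| ≤ C := by
  obtain ⟨R, hR⟩ := hrb
  intro t ht
  induction ht using Nat.decreasingInduction with
  | self =>
    rw [show V (T+1) = fun _ => 0 from funext hVT]
    exact ⟨measurable_const, 0, by simp⟩
  | of_succ t ht ih =>
    obtain ⟨hm, C, hC⟩ := ih
    have ht : t ≤ T := by omega
    rw [show V t = fun z => ⨆ a, Q t z a from funext (hV t ht)]
    refine ⟨Measurable.iSup fun a => ?_, R + C, fun z => ?_⟩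
    · simp_rw [hQ t ht]
      have integral_measurable : Measurable fun p => ∫ z', V (t+1) z' ∂((P t) p) :=
        hm.stronglyMeasurable.integral_kernel.measurable
      exact ((hrm t).add integral_measurable).comp measurable_prodMk_right
    · have h (a : A) : |Q t z a - 0| ≤ R + C := by
        rw [sub_zero, hQ t ht]
        refine (abs_add_le _ _).trans <| add_le_add (hR _ _) (abs_integral_le_of_abs_le _ hC)
      simpa using abs_ciSup_sub_ciSup_le h

/-- **Corollary: information-state values vs AIS values.**
Let `{σI}` be an exact information state generator (with reward functions `rbar` and kernels
`Pbar`), with value functions `Q̄, V̄` given by the information-state backward recursion, and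
let `{σ, Phat, rhat}` be an `(ε_t, δ_t)`-AIS generator with value functions `Q̂, V̂`.  Then
`|Q̄_t(σ_t(h_t),a_t) − Q̂_t(σ̂_t(h_t),a_t)| ≤ α_t` and
`|V̄_t(σ_t(h_t)) − V̂_t(σ̂_t(h_t))| ≤ α_t`, where `α_{T+1} = 0` and
`α_t = ε_t + ρ_𝔉(V̂_{t+1}) δ_t + α_{t+1}`. -/
theorem info_state_vs_ais_values
    {H0 Y A : Type u} [MeasurableSpace H0] [MeasurableSpace Y] [MeasurableSpace A]
    [Fintype A] [Nonempty A]
    (T : ℕ)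
    (obs : ∀ t, Kernel (Hist H0 Y A t × A) Y) [∀ t, IsMarkovKernel (obs t)]
    (r : ∀ t, Hist H0 Y A t × A → ℝ)
    (hrm : ∀ t, Measurable (r t)) (hrb : ∃ C : ℝ, ∀ t p, |r t p| ≤ C)
    -- an exact information state generator
    {Zb : ℕ → Type u} [∀ t, MeasurableSpace (Zb t)]
    (σI : ∀ t, Hist H0 Y A t → Zb t) (hσI : ∀ t, Measurable (σI t))
    (Pbar : ∀ t, Kernel (Zb t × A) (Zb (t+1))) [∀ t, IsMarkovKernel (Pbar t)]
    (rbar : ∀ t, Zb t × A → ℝ)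
    (hrbarm : ∀ t, Measurable (rbar t)) (hrbarb : ∃ C : ℝ, ∀ t p, |rbar t p| ≤ C)
    (hP1 : ∀ t ≤ T, ∀ (h : Hist H0 Y A t) (a : A),
      r t (h, a) = rbar t (σI t h, a))
    (hP2 : ∀ t ≤ T, ∀ (h : Hist H0 Y A t) (a : A),
      ((obs t) (h, a)).map (fun y => σI (t+1) ((h, y, a) : Hist H0 Y A (t+1)))
        = (Pbar t) (σI t h, a))
    -- the information-state value functions
    (Qbar : ∀ t, Zb t → A → ℝ) (Vbar : ∀ t, Zb t → ℝ)
    (hVbarT : ∀ z, Vbar (T+1) z = 0)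
    (hQbar : ∀ t ≤ T, ∀ (z : Zb t) (a : A),
      Qbar t z a = rbar t (z, a) + ∫ z', Vbar (t+1) z' ∂((Pbar t) (z, a)))
    (hVbar : ∀ t ≤ T, ∀ z : Zb t, Vbar t z = ⨆ a : A, Qbar t z a)
    -- the AIS generator
    {Z : ℕ → Type u} [∀ t, MeasurableSpace (Z t)]
    (σ : ∀ t, Hist H0 Y A t → Z t) (hσ : ∀ t, Measurable (σ t))
    (Phat : ∀ t, Kernel (Z t × A) (Z (t+1))) [∀ t, IsMarkovKernel (Phat t)]
    (rhat : ∀ t, Z t × A → ℝ)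
    (hrhatm : ∀ t, Measurable (rhat t)) (hrhatb : ∃ C : ℝ, ∀ t p, |rhat t p| ≤ C)
    (F : ∀ t, Set (Z t → ℝ)) (hF : ∀ t, UnifBddMeas (F t))
    (ε δ : ℕ → ℝ)
    (hAP1 : ∀ t ≤ T, ∀ (h : Hist H0 Y A t) (a : A),
      |r t (h, a) - rhat t (σ t h, a)| ≤ ε t)
    (hAP2 : ∀ t ≤ T, ∀ (h : Hist H0 Y A t) (a : A),
      ipm (F (t+1))
        (((obs t) (h, a)).map (fun y => σ (t+1) ((h, y, a) : Hist H0 Y A (t+1))))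
        ((Phat t) (σ t h, a)) ≤ δ t)
    -- the AIS value functions
    (Qhat : ∀ t, Z t → A → ℝ) (Vhat : ∀ t, Z t → ℝ)
    (hVhatT : ∀ z, Vhat (T+1) z = 0)
    (hQhat : ∀ t ≤ T, ∀ (z : Z t) (a : A),
      Qhat t z a = rhat t (z, a) + ∫ z', Vhat (t+1) z' ∂((Phat t) (z, a)))
    (hVhat : ∀ t ≤ T, ∀ z : Z t, Vhat t z = ⨆ a : A, Qhat t z a)
    -- finiteness of the Minkowski functionals ρ_𝔉(V̂_{t+1})
    (hmink : ∀ t ≤ T,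
      {c : ℝ | 0 < c ∧ (fun z => c⁻¹ * Vhat (t+1) z) ∈ F (t+1)}.Nonempty)
    -- the error recursion
    (α : ℕ → ℝ) (hαT : α (T+1) = 0)
    (hα : ∀ t ≤ T, α t = ε t + mink (F (t+1)) (Vhat (t+1)) * δ t + α (t+1)) :
    ∀ t ≤ T, ∀ (h : Hist H0 Y A t) (a : A),
      |Qbar t (σI t h) a - Qhat t (σ t h) a| ≤ α t ∧
      |Vbar t (σI t h) - Vhat t (σ t h)| ≤ α t := by
  have hbar := measurable_and_bounded_value T Pbar rbar hrbarm hrbarb Qbar Vbar hVbarT hQbar hVbar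
  have hhat := measurable_and_bounded_value T Phat rhat hrhatm hrhatb Qhat Vhat hVhatT hQhat hVhat
  have Q_of_V (t : ℕ) (ht : t ≤ T)
      (hV : ∀ h, |Vbar (t+1) (σI (t+1) h) - Vhat (t+1) (σ (t+1) h)| ≤ α (t+1))
      (h : Hist H0 Y A t) (a : A) : |Qbar t (σI t h) a - Qhat t (σ t h) a| ≤ α t := by
    have extend_measurable :
        Measurable fun y => ((h, y, a) : Hist H0 Y A (t+1)) :=
      (measurable_const.prodMk (measurable_id.prodMk measurable_const) :
        Measurable fun y : Y => (h, y, a))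
    have hmI := (hσI (t+1)).comp extend_measurable
    have hmA := (hσ (t+1)).comp extend_measurable
    obtain ⟨hVm, hVb⟩ := hbar (t+1) (by omega)
    obtain ⟨hVm', hVb'⟩ := hhat (t+1) (by omega)
    have : IsProbabilityMeasure
        (((obs t) (h, a)).map (fun y => σ (t+1) ((h, y, a) : Hist H0 Y A (t+1)))) :=
      Measure.isProbabilityMeasure_map hmA.aemeasurable
    have transition_error := abs_integral_sub_le_mink_mul (hF (t+1)) _ _ (hmink t ht)
      (hAP2 t ht h a)
    have value_error :
        |∫ z, Vbar (t+1) z ∂(Pbar t (σI t h, a)) - ∫ z, Vhat (t+1) z ∂(((obs t) (h, a)).map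
          (fun y => σ (t+1) ((h, y, a) : Hist H0 Y A (t+1))))| ≤ α (t+1) := by
      rw [← hP2 t ht]
      exact abs_integral_map_sub_integral_map_le _ hmI hmA hVm hVm' hVb hVb' fun _ => hV _
    have reward_error := hAP1 t ht h a
    rw [hP1 t ht] at reward_error
    rw [hQbar t ht, hQhat t ht, hα t ht]
    rw [abs_le] at *
    constructor <;> linarith
  have V_of_Q (t : ℕ) (ht : t ≤ T) (h : Hist H0 Y A t)
      (hQ : ∀ a, |Qbar t (σI t h) a - Qhat t (σ t h) a| ≤ α t) :
      |Vbar t (σI t h) - Vhat t (σ t h)| ≤ α t := by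
    rw [hVbar t ht, hVhat t ht]
    exact abs_ciSup_sub_ciSup_le hQ
  have V_error (t : ℕ) (ht : t ≤ T + 1) :
      ∀ h, |Vbar t (σI t h) - Vhat t (σ t h)| ≤ α t := by
    induction ht using Nat.decreasingInduction with
    | self => simp [hVbarT, hVhatT, hαT]
    | of_succ t ht ih =>
      have ht : t ≤ T := by omega
      exact fun h => V_of_Q t ht h (Q_of_V t ht ih h)
  exact fun t ht h a => ⟨Q_of_V t ht (V_error (t+1) (by omega)) h a, V_error t (by omega) h⟩
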